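/- arXiv:2410.22471 — 2 statements merged into one kernel-verified Lean document; each statement's English description precedes it below -/
import Mathlib

section
/- Let W be a real random variable with E[W] = 0, E[W²] < ∞, and M_W(w) = E[exp(w W)] < ∞ for all w ∈ [0, u] for some u > 0, and let β ∈ (0,1). Then the series Σ_{s=0}^{∞} ln M_W(u β^s) converges (its terms are nonnegative by Jensen's inequality and the series has a finite sum). -/
open MeasureTheory ProbabilityTheory

/-- A centred random variable has moment generating function at least `1` wherever it is finite. -/
lemma one_le_mgf_of_integral_eq_zero {Ω : Type*} {m : MeasurableSpace Ω} {μ : Measure Ω}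
    [IsProbabilityMeasure μ] {X : Ω → ℝ} (hX : Integrable X μ) (hmean : ∫ ω, X ω ∂μ = 0) {t : ℝ}
    (ht : Integrable (fun ω => Real.exp (t * X ω)) μ) : 1 ≤ mgf X μ t := by
  have h := integral_mono ((hX.const_mul t).add (integrable_const 1)) ht
    fun ω => Real.add_one_le_exp (t * X ω)
  simpa [mgf, integral_add (hX.const_mul t) (integrable_const 1), integral_const_mul, hmean]
    using h

/-- On `[0, u]` the moment generating function lies below its chord. -/
lemma mgf_mul_le_chord {Ω : Type*} {m : MeasurableSpace Ω} {μ : Measure Ω}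
    [IsProbabilityMeasure μ] {X : Ω → ℝ} {u θ : ℝ} (hθ : θ ∈ Set.Icc (0 : ℝ) 1)
    (hu : Integrable (fun ω => Real.exp (u * X ω)) μ)
    (hθu : Integrable (fun ω => Real.exp (u * θ * X ω)) μ) :
    mgf X μ (u * θ) ≤ 1 + θ * (mgf X μ u - 1) := by
  have hpt (ω : Ω) : Real.exp (u * θ * X ω) ≤ (1 - θ) + θ * Real.exp (u * X ω) := by
    have h := convexOn_exp.2 (Set.mem_univ 0) (Set.mem_univ (u * X ω))
      (sub_nonneg.2 hθ.2) hθ.1 (by ring)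
    simp only [smul_eq_mul, mul_zero, zero_add, Real.exp_zero, mul_one] at h
    rwa [mul_comm u θ, mul_assoc]
  have h := integral_mono hθu ((integrable_const (1 - θ)).add (hu.const_mul θ)) hpt
  have hsum : ∫ ω, ((1 - θ) + θ * Real.exp (u * X ω)) ∂μ = (1 - θ) + θ * mgf X μ u := by
    rw [integral_add (integrable_const _) (hu.const_mul θ), integral_const_mul]
    simp [mgf]
  calc mgf X μ (u * θ) ≤ (1 - θ) + θ * mgf X μ u := hsum ▸ h
    _ = 1 + θ * (mgf X μ u - 1) := by ring

/-- If `W` has mean `0`, finite second moment, and MGF finite on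
`[0, u]` for some `u > 0`, and `β ∈ (0,1)`, then the series
`∑_{s=0}^{∞} ln M_W(u β^s)` converges (has a finite sum). -/
theorem summable_log_mgf_geometric
    {Ω : Type*} [MeasureSpace Ω] [IsProbabilityMeasure (ℙ : Measure Ω)]
    (W : Ω → ℝ) (hWmeas : Measurable W)
    (hWint : Integrable W ℙ) (hWmean : ∫ ω, W ω ∂ℙ = 0)
    (hWsq : Integrable (fun ω => W ω ^ 2) ℙ)
    (u : ℝ) (hu : 0 < u) (β : ℝ) (hβ : β ∈ Set.Ioo (0 : ℝ) 1)
    (hMGF : ∀ w ∈ Set.Icc (0 : ℝ) u, Integrable (fun ω => Real.exp (w * W ω)) ℙ) :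
    Summable (fun s : ℕ => Real.log (mgf W ℙ (u * β ^ s))) := by
  have hpow (s : ℕ) : β ^ s ∈ Set.Icc (0 : ℝ) 1 :=
    ⟨pow_nonneg hβ.1.le s, pow_le_one₀ hβ.1.le hβ.2.le⟩
  have hint (s : ℕ) : Integrable (fun ω => Real.exp (u * β ^ s * W ω)) ℙ :=
    hMGF _ ⟨mul_nonneg hu.le (hpow s).1, mul_le_of_le_one_right hu.le (hpow s).2⟩
  have hone (s : ℕ) : 1 ≤ mgf W ℙ (u * β ^ s) :=
    one_le_mgf_of_integral_eq_zero hWint hWmean (hint s)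
  refine Summable.of_nonneg_of_le (fun s => Real.log_nonneg (hone s)) (fun s => ?_)
    ((summable_geometric_of_lt_one hβ.1.le hβ.2).mul_right (mgf W ℙ u - 1))
  have hchord := mgf_mul_le_chord (hpow s) (hMGF u ⟨hu.le, le_rfl⟩) (hint s)
  linarith [Real.log_le_sub_one_of_pos (zero_lt_one.trans_le (hone s))]
end

section
/- Let ν > 0, let Γ be a random variable with Gamma distribution with shape parameter 1/ν and rate parameter 1/ν (so that E[Γ] = 1, with density x ↦ (1/ν)^{1/ν} / Γ(1/ν) · x^{1/ν − 1} e^{−x/ν} on (0,∞)), let Y be a standard normal random variable independent of Γ, let a, b, c ∈ ℝ, and set X = c + aΓ + b√Γ · Y (the variance-gamma random variable). Then for every t ∈ ℝ with 1 − aνt − b²νt²/2 > 0, the moment generating function is finite and equals E[exp(tX)] = exp(ct) · (1 − aνt − b²νt²/2)^{−1/ν}. -/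
open MeasureTheory ProbabilityTheory

theorem measurable_gammaPDF (p r : ℝ) : Measurable (gammaPDF p r) :=
  (measurable_gammaPDFReal p r).ennreal_ofReal

theorem lintegral_exp_mul_gaussianReal (s : ℝ) :
    ∫⁻ y, ENNReal.ofReal (Real.exp (s * y)) ∂(gaussianReal 0 1)
      = ENNReal.ofReal (Real.exp (s ^ 2 / 2)) := by
  rw [← ofReal_integral_eq_lintegral_ofReal (integrable_exp_mul_gaussianReal s)
    (ae_of_all _ fun _ ↦ (Real.exp_pos _).le)]
  have h := congrFun (mgf_fun_id_gaussianReal (μ := 0) (v := 1)) s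
  simp only [mgf, zero_mul, zero_add, NNReal.coe_one, one_mul] at h
  rw [h]

theorem gammaPDFReal_mul_exp {p r s : ℝ} (hr : 0 < r) (hs : s < r) (x : ℝ) :
    gammaPDFReal p r x * Real.exp (s * x)
      = (1 - s / r) ^ (-p) * gammaPDFReal p (r - s) x := by
  have hrs : 0 < r - s := sub_pos.2 hs
  unfold gammaPDFReal
  split_ifs with hx
  · have hexp : Real.exp (-(r * x)) * Real.exp (s * x) = Real.exp (-((r - s) * x)) := by
      rw [← Real.exp_add]; ring_nf
    have hpow : (1 - s / r) ^ (-p) * (r - s) ^ p = r ^ p := by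
      rw [one_sub_div hr.ne', Real.rpow_neg (by positivity), Real.div_rpow hrs.le hr.le]
      have := (Real.rpow_pos_of_pos hrs p).ne'
      field_simp
    rw [mul_assoc, hexp, ← hpow]
    ring
  · simp

theorem lintegral_exp_mul_gammaMeasure {p r s : ℝ} (hp : 0 < p) (hr : 0 < r) (hs : s < r) :
    ∫⁻ x, ENNReal.ofReal (Real.exp (s * x)) ∂(gammaMeasure p r)
      = ENNReal.ofReal ((1 - s / r) ^ (-p)) := by
  have hrs : 0 < r - s := sub_pos.2 hs
  have hbase : 0 < 1 - s / r := by rw [one_sub_div hr.ne']; positivity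
  rw [gammaMeasure, lintegral_withDensity_eq_lintegral_mul _
    (measurable_gammaPDF p r) (by fun_prop)]
  have h (x : ℝ) : (gammaPDF p r * fun x ↦ ENNReal.ofReal (Real.exp (s * x))) x
      = ENNReal.ofReal ((1 - s / r) ^ (-p)) * gammaPDF p (r - s) x := by
    rw [Pi.mul_apply, gammaPDF, gammaPDF, ← ENNReal.ofReal_mul (gammaPDFReal_nonneg hp hr x),
      gammaPDFReal_mul_exp hr hs, ENNReal.ofReal_mul (by positivity)]
  rw [lintegral_congr h, lintegral_const_mul _ (measurable_gammaPDF p (r - s)),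
    lintegral_gammaPDF_eq_one hp hrs, mul_one]

theorem ae_nonneg_gammaMeasure (p r : ℝ) : ∀ᵐ x ∂(gammaMeasure p r), 0 ≤ x := by
  rw [gammaMeasure, ae_withDensity_iff (measurable_gammaPDF p r)]
  refine ae_of_all _ fun x hx ↦ ?_
  by_contra! h
  exact hx (gammaPDF_of_neg h)

theorem lintegral_exp_gaussian_mixture_gammaMeasure {p r : ℝ} (hp : 0 < p) (hr : 0 < r)
    (a b c t : ℝ) (ht : t * a + (t * b) ^ 2 / 2 < r) :
    ∫⁻ z, ENNReal.ofReal (Real.exp (t * (c + a * z.1 + b * Real.sqrt z.1 * z.2)))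
        ∂((gammaMeasure p r).prod (gaussianReal 0 1))
      = ENNReal.ofReal
          (Real.exp (c * t) * (1 - (t * a + (t * b) ^ 2 / 2) / r) ^ (-p)) := by
  rw [lintegral_prod _ (by fun_prop), ENNReal.ofReal_mul (Real.exp_pos _).le,
    ← lintegral_exp_mul_gammaMeasure hp hr ht, ← lintegral_const_mul _ (by fun_prop)]
  refine lintegral_congr_ae ?_
  filter_upwards [ae_nonneg_gammaMeasure p r] with x hx
  have h (y : ℝ) : ENNReal.ofReal (Real.exp (t * (c + a * x + b * Real.sqrt x * y)))
      = ENNReal.ofReal (Real.exp (c * t + t * a * x))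
        * ENNReal.ofReal (Real.exp (t * b * Real.sqrt x * y)) := by
    rw [← ENNReal.ofReal_mul (Real.exp_pos _).le, ← Real.exp_add]
    ring_nf
  simp only [h]
  rw [lintegral_const_mul _ (by fun_prop), lintegral_exp_mul_gaussianReal,
    ← ENNReal.ofReal_mul (Real.exp_pos _).le, ← ENNReal.ofReal_mul (Real.exp_pos _).le,
    ← Real.exp_add, ← Real.exp_add, mul_pow, Real.sq_sqrt hx]
  ring_nf

/-- Let `ν > 0`, let `Γ` have the Gamma distribution with shape
`1/ν` and rate `1/ν` (so `E[Γ] = 1`), let `Y ∼ N(0,1)` be independent of `Γ`, and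
set `X = c + aΓ + b√Γ·Y` (variance-gamma). Then for every `t ∈ ℝ` with
`1 - aνt - b²νt²/2 > 0`, the MGF is finite and equals
`E[exp(tX)] = exp(ct) · (1 - aνt - b²νt²/2)^{-1/ν}`. -/
theorem varianceGamma_mgf
    {Ω : Type*} [MeasureSpace Ω] [IsProbabilityMeasure (ℙ : Measure Ω)]
    (ν : ℝ) (hν : 0 < ν) (a b c : ℝ)
    (G Y : Ω → ℝ) (hGmeas : Measurable G) (hYmeas : Measurable Y)
    (hGlaw : Measure.map G ℙ = gammaMeasure (1 / ν) (1 / ν))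
    (hYlaw : Measure.map Y ℙ = gaussianReal 0 1)
    (hGY : IndepFun G Y ℙ)
    (X : Ω → ℝ)
    (hX : ∀ ω, X ω = c + a * G ω + b * Real.sqrt (G ω) * Y ω) :
    ∀ t : ℝ, 0 < 1 - a * ν * t - b ^ 2 * ν * t ^ 2 / 2 →
      Integrable (fun ω => Real.exp (t * X ω)) ℙ ∧
      ∫ ω, Real.exp (t * X ω) ∂ℙ =
        Real.exp (c * t) * (1 - a * ν * t - b ^ 2 * ν * t ^ 2 / 2) ^ (-(1 / ν)) := by
  intro t ht
  have hlt : t * a + (t * b) ^ 2 / 2 < 1 / ν := by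
    rw [lt_div_iff₀ hν]; linarith
  have hbase : 1 - (t * a + (t * b) ^ 2 / 2) / (1 / ν)
      = 1 - a * ν * t - b ^ 2 * ν * t ^ 2 / 2 := by
    rw [div_div_eq_mul_div, div_one]; ring
  have hXeq : X = fun ω ↦ c + a * G ω + b * Real.sqrt (G ω) * Y ω := funext hX
  have hXmeas : Measurable X := by rw [hXeq]; fun_prop
  have hlint : ∫⁻ ω, ENNReal.ofReal (Real.exp (t * X ω)) ∂ℙ = ENNReal.ofReal
      (Real.exp (c * t) * (1 - a * ν * t - b ^ 2 * ν * t ^ 2 / 2) ^ (-(1 / ν))) := by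
    have hν' : 0 < 1 / ν := by positivity
    rw [← hbase, ← lintegral_exp_gaussian_mixture_gammaMeasure hν' hν' a b c t hlt,
      ← hGlaw, ← hYlaw,
      ← hGY.map_prod_eq_prod_map_map hGmeas.aemeasurable hYmeas.aemeasurable,
      lintegral_map (by fun_prop) (by fun_prop)]
    simp only [hX]
  have hnonneg : 0 ≤ᵐ[ℙ] fun ω ↦ Real.exp (t * X ω) := ae_of_all _ fun _ ↦ (Real.exp_pos _).le
  have hmeas : AEStronglyMeasurable (fun ω ↦ Real.exp (t * X ω)) ℙ :=
    (by fun_prop : Measurable fun ω ↦ Real.exp (t * X ω)).aestronglyMeasurable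
  refine ⟨⟨hmeas, ?_⟩, ?_⟩
  · rw [hasFiniteIntegral_iff_ofReal hnonneg, hlint]
    exact ENNReal.ofReal_lt_top
  · rw [integral_eq_lintegral_of_nonneg_ae hnonneg hmeas, hlint,
      ENNReal.toReal_ofReal (by positivity)]
end
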